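/- arXiv:1203.0030 — 2 statements merged into one kernel-verified Lean document; each statement's English description precedes it below -/
import Mathlib

section
/- Let A ∈ ℝ^{n×n}, B ∈ ℝ^{n×m}, let Q1 ∈ ℝ^{n×n} be positive semidefinite, Q2 ∈ ℝ^{m×m} positive definite, and S ∈ ℝ^{n×n} positive semidefinite. Then the Riccati update ρ(S) = Q1 + AᵀSA − AᵀSB (Q2 + BᵀSB)^{−1} BᵀSA is positive semidefinite. -/
open Matrix

/-- **Joseph form** of the Riccati update: completing the square with any `L` solving
`(Q2 + BᵀSB) L = BᵀSA`. -/
theorem riccati_eq_joseph_form {n m R : Type*} [Fintype n] [Fintype m] [CommRing R]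
    {A S : Matrix n n R} {B : Matrix n m R} {Q2 : Matrix m m R} {L : Matrix m n R}
    (hL : (Q2 + Bᵀ * S * B) * L = Bᵀ * S * A) :
    Aᵀ * S * A - Aᵀ * S * B * L = (A - B * L)ᵀ * S * (A - B * L) + Lᵀ * Q2 * L := by
  have h : Lᵀ * Q2 * L = Lᵀ * (Bᵀ * S * A) - Lᵀ * (Bᵀ * S * B) * L := by
    simp only [← hL, Matrix.mul_add, Matrix.add_mul, Matrix.mul_assoc, add_sub_cancel_right]
  rw [h, transpose_sub, transpose_mul]
  simp only [Matrix.mul_sub, Matrix.sub_mul, Matrix.mul_assoc]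
  abel

/-- The Riccati update `ρ(S) = Q1 + AᵀSA − AᵀSB (Q2 + BᵀSB)⁻¹ BᵀSA` of a positive
semidefinite matrix `S` is positive semidefinite (for `Q1 ⪰ 0`, `Q2 ≻ 0`). -/
theorem stmt4 {n m : ℕ} (A : Matrix (Fin n) (Fin n) ℝ) (B : Matrix (Fin n) (Fin m) ℝ)
    (Q1 : Matrix (Fin n) (Fin n) ℝ) (hQ1 : Q1.PosSemidef)
    (Q2 : Matrix (Fin m) (Fin m) ℝ) (hQ2 : Q2.PosDef)
    (S : Matrix (Fin n) (Fin n) ℝ) (hS : S.PosSemidef) :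
    (Q1 + Aᵀ * S * A - Aᵀ * S * B * (Q2 + Bᵀ * S * B)⁻¹ * Bᵀ * S * A).PosSemidef := by
  have hM : (Q2 + Bᵀ * S * B).PosDef := hQ2.add_posSemidef (by
    simpa only [conjTranspose_eq_transpose_of_trivial] using hS.conjTranspose_mul_mul_same B)
  set L := (Q2 + Bᵀ * S * B)⁻¹ * (Bᵀ * S * A) with hL_def
  have hL : (Q2 + Bᵀ * S * B) * L = Bᵀ * S * A :=
    mul_nonsing_inv_cancel_left _ _ ((isUnit_iff_isUnit_det _).mp hM.isUnit)
  have key : Q1 + Aᵀ * S * A - Aᵀ * S * B * (Q2 + Bᵀ * S * B)⁻¹ * Bᵀ * S * A =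
      Q1 + ((A - B * L)ᵀ * S * (A - B * L) + Lᵀ * Q2 * L) := by
    rw [← riccati_eq_joseph_form hL, add_sub_assoc, hL_def]
    simp only [Matrix.mul_assoc]
  rw [key]
  simpa only [conjTranspose_eq_transpose_of_trivial] using
    hQ1.add ((hS.conjTranspose_mul_mul_same (A - B * L)).add
      (hQ2.posSemidef.conjTranspose_mul_mul_same L))
end

section
/- Let x_{k+1} = A x_k + B u_k + w_k and let δ : ℕ → {0,1}. Define estimates recursively by x̂_0 = δ_0 x_0 and, for k ≥ 1, x̂_k = δ_k x_k + (1 − δ_k)(A x̂_{k−1} + B u_{k−1}). Define the prediction errors e_k = x_k − (A x̂_{k−1} + B u_{k−1}) for k ≥ 1. Then e_1 = A (1 − δ_0) x_0 + w_0 and e_k = A (1 − δ_{k−1}) e_{k−1} + w_{k−1} for k ≥ 2. In particular, if u and u' are two control sequences generating (via the same x_0, w, δ) states x, x' and estimates x̂, x̂', then the corresponding prediction errors are equal: e_k = e'_k for all k ≥ 1. -/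
open Matrix

/-- One step of the prediction error: the applied control cancels. -/
theorem predictionError_succ {n m : ℕ} {A : Matrix (Fin n) (Fin n) ℝ}
    {B : Matrix (Fin n) (Fin m) ℝ} {x w xhat e : ℕ → (Fin n → ℝ)} {u : ℕ → (Fin m → ℝ)}
    (hx : ∀ k, x (k + 1) = A.mulVec (x k) + B.mulVec (u k) + w k)
    (he : ∀ k ≥ 1, e k = x k - (A.mulVec (xhat (k - 1)) + B.mulVec (u (k - 1)))) (k : ℕ) :
    e (k + 1) = A.mulVec (x k - xhat k) + w k := by
  rw [he (k + 1) (by omega), Nat.add_sub_cancel, hx, Matrix.mulVec_sub]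
  abel

theorem predictionError_recursion {n m : ℕ} {A : Matrix (Fin n) (Fin n) ℝ}
    {B : Matrix (Fin n) (Fin m) ℝ} {δ : ℕ → ℝ} {x w xhat e : ℕ → (Fin n → ℝ)}
    {u : ℕ → (Fin m → ℝ)}
    (hx : ∀ k, x (k + 1) = A.mulVec (x k) + B.mulVec (u k) + w k)
    (hxhat0 : xhat 0 = δ 0 • x 0)
    (hxhat : ∀ k ≥ 1, xhat k
      = δ k • x k + (1 - δ k) • (A.mulVec (xhat (k - 1)) + B.mulVec (u (k - 1))))
    (he : ∀ k ≥ 1, e k = x k - (A.mulVec (xhat (k - 1)) + B.mulVec (u (k - 1)))) :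
    e 1 = (1 - δ 0) • A.mulVec (x 0) + w 0
    ∧ ∀ k ≥ 1, e (k + 1) = (1 - δ k) • A.mulVec (e k) + w k := by
  refine ⟨?_, fun k hk => ?_⟩
  · rw [predictionError_succ hx he 0, hxhat0, ← Matrix.mulVec_smul, sub_smul, one_smul]
  · have hfilter : x k - xhat k = (1 - δ k) • e k := by
      rw [hxhat k hk, he k hk]
      module
    rw [predictionError_succ hx he k, hfilter, Matrix.mulVec_smul]

/-- For the dual predictor `x̂_k = δ_k x_k + (1−δ_k)(A x̂_{k−1} + B u_{k−1})`, the
prediction errors `e_k = x_k − (A x̂_{k−1} + B u_{k−1})` satisfy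
`e_1 = A(1−δ_0)x_0 + w_0` and `e_k = A(1−δ_{k−1})e_{k−1} + w_{k−1}` for `k ≥ 2`;
in particular they do not depend on the applied controls: for two control sequences
`u`, `u'` generating (via the same `x_0`, `w`, `δ`) states `x`, `x'` and estimates
`x̂`, `x̂'`, the prediction errors coincide. -/
theorem stmt9 {n m : ℕ} (A : Matrix (Fin n) (Fin n) ℝ) (B : Matrix (Fin n) (Fin m) ℝ)
    (δ : ℕ → ℝ) (hδ01 : ∀ k, δ k = 0 ∨ δ k = 1)
    (x w xhat e : ℕ → (Fin n → ℝ)) (u : ℕ → (Fin m → ℝ))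
    (hx : ∀ k, x (k + 1) = A.mulVec (x k) + B.mulVec (u k) + w k)
    (hxhat0 : xhat 0 = δ 0 • x 0)
    (hxhat : ∀ k ≥ 1, xhat k
      = δ k • x k + (1 - δ k) • (A.mulVec (xhat (k - 1)) + B.mulVec (u (k - 1))))
    (he : ∀ k ≥ 1, e k = x k - (A.mulVec (xhat (k - 1)) + B.mulVec (u (k - 1))))
    (x' xhat' e' : ℕ → (Fin n → ℝ)) (u' : ℕ → (Fin m → ℝ))
    (hx'0 : x' 0 = x 0)
    (hx' : ∀ k, x' (k + 1) = A.mulVec (x' k) + B.mulVec (u' k) + w k)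
    (hxhat'0 : xhat' 0 = δ 0 • x' 0)
    (hxhat' : ∀ k ≥ 1, xhat' k
      = δ k • x' k + (1 - δ k) • (A.mulVec (xhat' (k - 1)) + B.mulVec (u' (k - 1))))
    (he' : ∀ k ≥ 1, e' k = x' k - (A.mulVec (xhat' (k - 1)) + B.mulVec (u' (k - 1)))) :
    e 1 = (1 - δ 0) • A.mulVec (x 0) + w 0
    ∧ (∀ k ≥ 2, e k = (1 - δ (k - 1)) • A.mulVec (e (k - 1)) + w (k - 1))
    ∧ (∀ k ≥ 1, e k = e' k) := by
  obtain ⟨h1, hrec⟩ := predictionError_recursion hx hxhat0 hxhat he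
  obtain ⟨h1', hrec'⟩ := predictionError_recursion hx' hxhat'0 hxhat' he'
  refine ⟨h1, fun k hk => ?_, fun k hk => ?_⟩
  · obtain ⟨j, rfl⟩ := Nat.exists_eq_add_of_le' (Nat.le_of_succ_le hk)
    exact hrec j (by omega)
  · induction k, hk using Nat.le_induction with
    | base => rw [h1, h1', hx'0]
    | succ k hk ih => rw [hrec k hk, hrec' k hk, ih]
end
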